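/- For the KKM potential V_II, the square of the Poisson bracket C₂ = {A₂,B₂} satisfies C₂² = 2F₂, where F₂ = 8(β(−B₂² + (A₁−H)² − 4αβ) − A₂(B₂² + 4αβ) + γ(B₂(B₂+H−A₁) + 4αβ) − αγ²), and consequently {A₂,{A₂,B₂}} = −16A₂B₂ − 16(β−γ)B₂ − 8γ(A₁−H). -/

import Mathlib

noncomputable section

open MvPolynomial

/-- The field of rational functions over ℂ in the six variables
`x, y, z, p_x, p_y, p_z`: the fraction field of the polynomial ring. -/
abbrev K6 : Type := FractionRing (MvPolynomial (Fin 6) ℂ)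

/-- The canonical embedding of the polynomial ring into its fraction field. -/
def toK6 : MvPolynomial (Fin 6) ℂ →+* K6 :=
  algebraMap (MvPolynomial (Fin 6) ℂ) K6

/-- Constants, embedded in `K6`. -/
def cC (a : ℂ) : K6 := toK6 (MvPolynomial.C a)

/-- The imaginary unit `i`, embedded in `K6`. -/
def iC : K6 := cC Complex.I

def vx : K6 := toK6 (MvPolynomial.X 0)
def vy : K6 := toK6 (MvPolynomial.X 1)
def vz : K6 := toK6 (MvPolynomial.X 2)
def vpx : K6 := toK6 (MvPolynomial.X 3)
def vpy : K6 := toK6 (MvPolynomial.X 4)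
def vpz : K6 := toK6 (MvPolynomial.X 5)

/-- `D` is the (unique) extension to the fraction field of the formal partial
derivative `pderiv j` on the polynomial ring: an additive map satisfying the
Leibniz rule which agrees with `pderiv j` on polynomials. -/
def IsPDeriv (j : Fin 6) (D : K6 → K6) : Prop :=
  (∀ f g : K6, D (f + g) = D f + D g) ∧
  (∀ f g : K6, D (f * g) = D f * g + f * D g) ∧
  (∀ p, D (toK6 p) = toK6 (pderiv j p))

/-- The canonical Poisson bracket on `K6`, where `Pd 0, …, Pd 5` are the
partial derivatives with respect to `x, y, z, p_x, p_y, p_z` respectively: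
`{f,g} = f_x g_{p_x} + f_y g_{p_y} + f_z g_{p_z}
  - f_{p_x} g_x - f_{p_y} g_y - f_{p_z} g_z`. -/
def poisson (Pd : Fin 6 → K6 → K6) (f g : K6) : K6 :=
  Pd 0 f * Pd 3 g + Pd 1 f * Pd 4 g + Pd 2 f * Pd 5 g
    - Pd 3 f * Pd 0 g - Pd 4 f * Pd 1 g - Pd 5 f * Pd 2 g

/-- Angular momentum `J_x = y p_z - z p_y`. -/
def Jx : K6 := vy * vpz - vz * vpy
/-- Angular momentum `J_y = z p_x - x p_z`. -/
def Jy : K6 := vz * vpx - vx * vpz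
/-- Angular momentum `J_z = x p_y - y p_x`. -/
def Jz : K6 := vx * vpy - vy * vpx
/-- Total angular momentum squared `J² = J_x² + J_y² + J_z²`. -/
def Jsq : K6 := Jx ^ 2 + Jy ^ 2 + Jz ^ 2

/-- KKM V_II Hamiltonian. -/
def HV (α β γ δ : ℂ) : K6 :=
  vpx ^ 2 + vpy ^ 2 + vpz ^ 2 + cC α * (vx ^ 2 + vy ^ 2 + vz ^ 2)
    + cC β * (vx - iC * vy) / (vx + iC * vy) ^ 3
    + cC γ / (vx + iC * vy) ^ 2 + cC δ / vz ^ 2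

def A1V (α δ : ℂ) : K6 := vpz ^ 2 + cC α * vz ^ 2 + cC δ / vz ^ 2

def A2V (β γ : ℂ) : K6 :=
  Jz ^ 2 + 2 * iC * vx * vy * (cC γ - 2 * cC β) / (vx + iC * vy) ^ 2
    + 2 * cC γ * vx ^ 2 / (vx + iC * vy) ^ 2

def B1V (β γ δ : ℂ) : K6 :=
  Jsq
    + (vz ^ 2 * (cC β * (4 * vx * vy * (vy - iC * vx) + vz ^ 2 * (vx - iC * vy))
        + cC γ * (vx + iC * vy) * (2 * vx * (vx + iC * vy) + vz ^ 2))
      + cC δ * (vx - iC * vy) * (vx + iC * vy) ^ 4)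
      / (vz ^ 2 * (vx + iC * vy) ^ 3)

def B2V (α β : ℂ) : K6 :=
  (vpx + iC * vpy) ^ 2 + cC α * (vx + iC * vy) ^ 2 - cC β / (vx + iC * vy) ^ 2

def FV (β δ : ℂ) : K6 :=
  (Jy - iC * Jx) ^ 2
    + (cC δ * (vx + iC * vy) ^ 4 - cC β * vz ^ 4) / (vz ^ 2 * (vx + iC * vy) ^ 2)

/-- A map satisfying `IsPDeriv`, bundled as a `ℂ`-derivation of `K6`. -/
def IsPDeriv.derivation {j : Fin 6} {D : K6 → K6} (hD : IsPDeriv j D) :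
    Derivation ℂ K6 K6 :=
  Derivation.mk'
    { toFun := D
      map_add' := hD.1
      map_smul' := fun a f => by
        have ha : a • f = toK6 (C a) * f := by
          rw [Algebra.smul_def, IsScalarTower.algebraMap_apply ℂ (MvPolynomial (Fin 6) ℂ) K6]
          rfl
        have ha' : a • D f = toK6 (C a) * D f := by
          rw [Algebra.smul_def, IsScalarTower.algebraMap_apply ℂ (MvPolynomial (Fin 6) ℂ) K6]
          rfl
        simp only [RingHom.id_apply]
        rw [ha, ha', hD.2.1, hD.2.2, pderiv_C, map_zero, zero_mul, zero_add] }
    fun f g => by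
      change D (f * g) = f * D g + g * D f
      rw [hD.2.1]
      ring

lemma IsPDeriv.derivation_apply {j : Fin 6} {D : K6 → K6} (hD : IsPDeriv j D) (f : K6) :
    hD.derivation f = D f := rfl

lemma IsPDeriv.derivation_X {j : Fin 6} {D : K6 → K6} (hD : IsPDeriv j D) (k : Fin 6) :
    hD.derivation (toK6 (X k)) = if k = j then 1 else 0 := by
  rw [hD.derivation_apply, hD.2.2, pderiv_X, Pi.single_apply]
  split_ifs <;> simp_all

lemma IsPDeriv.derivation_vx {j : Fin 6} {D : K6 → K6} (hD : IsPDeriv j D) :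
    hD.derivation vx = if 0 = j then 1 else 0 := hD.derivation_X 0

lemma IsPDeriv.derivation_vy {j : Fin 6} {D : K6 → K6} (hD : IsPDeriv j D) :
    hD.derivation vy = if 1 = j then 1 else 0 := hD.derivation_X 1

lemma IsPDeriv.derivation_vpx {j : Fin 6} {D : K6 → K6} (hD : IsPDeriv j D) :
    hD.derivation vpx = if 3 = j then 1 else 0 := hD.derivation_X 3

lemma IsPDeriv.derivation_vpy {j : Fin 6} {D : K6 → K6} (hD : IsPDeriv j D) :
    hD.derivation vpy = if 4 = j then 1 else 0 := hD.derivation_X 4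

lemma cC_eq_algebraMap (a : ℂ) : cC a = algebraMap ℂ K6 a :=
  (IsScalarTower.algebraMap_apply ℂ (MvPolynomial (Fin 6) ℂ) K6 a).symm

lemma derivation_cC (D : Derivation ℂ K6 K6) (a : ℂ) : D (cC a) = 0 := by
  rw [cC_eq_algebraMap, D.map_algebraMap]

lemma derivation_iC (D : Derivation ℂ K6 K6) : D iC = 0 := derivation_cC D _

lemma iC_sq : iC ^ 2 = -1 := by
  rw [iC, cC_eq_algebraMap, ← map_pow, Complex.I_sq, map_neg, map_one]

lemma vx_add_iC_mul_vy_ne_zero : vx + iC * vy ≠ 0 := by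
  have hne : (X 0 + C Complex.I * X 1 : MvPolynomial (Fin 6) ℂ) ≠ 0 := fun h => by
    simpa using congrArg (eval (Pi.single 0 1)) h
  have := (map_ne_zero_iff toK6 (IsFractionRing.injective (MvPolynomial (Fin 6) ℂ) K6)).2 hne
  simpa [vx, vy, iC, cC] using this

/-- The Hamiltonian vector field `{f, ·}` as a derivation. -/
def hamiltonianDerivation {Pd : Fin 6 → K6 → K6} (hPd : ∀ j, IsPDeriv j (Pd j)) (f : K6) :
    Derivation ℂ K6 K6 :=
  Pd 0 f • (hPd 3).derivation + Pd 1 f • (hPd 4).derivation + Pd 2 f • (hPd 5).derivation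
    - Pd 3 f • (hPd 0).derivation - Pd 4 f • (hPd 1).derivation - Pd 5 f • (hPd 2).derivation

lemma hamiltonianDerivation_apply {Pd : Fin 6 → K6 → K6} (hPd : ∀ j, IsPDeriv j (Pd j))
    (f g : K6) : hamiltonianDerivation hPd f g = poisson Pd f g := rfl

/-- `A₂` in the coordinates `w = x + iy`, `v = x - iy`. -/
lemma A2V_eq (β γ : ℂ) :
    A2V β γ = Jz ^ 2 + cC γ * (1 + (vx - iC * vy) * (vx + iC * vy)⁻¹) - cC β
      + cC β * ((vx - iC * vy) * (vx + iC * vy)⁻¹) ^ 2 := by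
  have hw := vx_add_iC_mul_vy_ne_zero
  rw [A2V]
  field_simp
  ring

/-- `A₂` in terms of `w = x + iy`, `v = x - iy` and `-i J_z`. -/
lemma A2V_eq_neg_sq (β γ : ℂ) :
    A2V β γ = -(-iC * Jz) ^ 2 + cC γ * (1 + (vx - iC * vy) / (vx + iC * vy)) - cC β
      + cC β * ((vx - iC * vy) / (vx + iC * vy)) ^ 2 := by
  rw [A2V_eq]
  linear_combination Jz ^ 2 * iC_sq

/-- `A₁ - H` in terms of `w = x + iy`, `v = x - iy`, `p₊ = p_x + i p_y` and `-i J_z`. -/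
lemma A1V_sub_HV (α β γ δ : ℂ) :
    A1V α δ - HV α β γ δ =
      -((2 * (-iC * Jz) * (vpx + iC * vpy) + (vx - iC * vy) *
        ((vpx + iC * vpy) ^ 2 + cC α * (vx + iC * vy) ^ 2 + cC β / (vx + iC * vy) ^ 2))
          / (vx + iC * vy) + cC γ / (vx + iC * vy) ^ 2) := by
  have hw := vx_add_iC_mul_vy_ne_zero
  have hp : (2 * (-iC * Jz) * (vpx + iC * vpy) + (vx - iC * vy) * (vpx + iC * vpy) ^ 2)
      / (vx + iC * vy) = vpx ^ 2 + vpy ^ 2 := by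
    rw [div_eq_iff hw, Jz]
    linear_combination (-vx * vpy ^ 2 - iC * vy * vpy ^ 2) * iC_sq
  have hx : (vx - iC * vy) * (vx + iC * vy) = vx ^ 2 + vy ^ 2 := by
    linear_combination -vy ^ 2 * iC_sq
  have hsplit : (2 * (-iC * Jz) * (vpx + iC * vpy) + (vx - iC * vy) *
      ((vpx + iC * vpy) ^ 2 + cC α * (vx + iC * vy) ^ 2 + cC β / (vx + iC * vy) ^ 2))
        / (vx + iC * vy) = vpx ^ 2 + vpy ^ 2 + cC α * (vx ^ 2 + vy ^ 2)
          + cC β * (vx - iC * vy) / (vx + iC * vy) ^ 3 := by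
    rw [← hp, ← hx]
    field_simp
    ring
  rw [hsplit, A1V, HV]
  ring

/-! The following lemmas compute the Hamiltonian vector field of `A₂` on `w = x + iy`,
`v = x - iy`, `p₊ = p_x + i p_y` and `-i J_z`, which generate a closed Poisson algebra. -/

lemma hamiltonianDerivation_A2V_add {Pd : Fin 6 → K6 → K6} (hPd : ∀ j, IsPDeriv j (Pd j))
    (β γ : ℂ) :
    hamiltonianDerivation hPd (A2V β γ) (vx + iC * vy) =
      2 * (-iC * Jz) * (vx + iC * vy) := by
  simp [hamiltonianDerivation, ← IsPDeriv.derivation_apply (hPd _), A2V_eq, Jz,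
    Derivation.leibniz_pow, Derivation.leibniz_inv, derivation_cC, derivation_iC,
    IsPDeriv.derivation_vx, IsPDeriv.derivation_vy, IsPDeriv.derivation_vpx,
    IsPDeriv.derivation_vpy]
  linear_combination 2 * (vx * vpy - vy * vpx) * vy * iC_sq

lemma hamiltonianDerivation_A2V_sub {Pd : Fin 6 → K6 → K6} (hPd : ∀ j, IsPDeriv j (Pd j))
    (β γ : ℂ) :
    hamiltonianDerivation hPd (A2V β γ) (vx - iC * vy) =
      -2 * (-iC * Jz) * (vx - iC * vy) := by
  simp [hamiltonianDerivation, ← IsPDeriv.derivation_apply (hPd _), A2V_eq, Jz,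
    Derivation.leibniz_pow, Derivation.leibniz_inv, derivation_cC, derivation_iC,
    IsPDeriv.derivation_vx, IsPDeriv.derivation_vy, IsPDeriv.derivation_vpx,
    IsPDeriv.derivation_vpy]
  linear_combination 2 * (vx * vpy - vy * vpx) * vy * iC_sq

lemma hamiltonianDerivation_A2V_momentum {Pd : Fin 6 → K6 → K6} (hPd : ∀ j, IsPDeriv j (Pd j))
    (β γ : ℂ) :
    hamiltonianDerivation hPd (A2V β γ) (vpx + iC * vpy) =
      2 * (-iC * Jz) * (vpx + iC * vpy) + 2 * (cC γ / (vx + iC * vy)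
        + 2 * cC β * (vx - iC * vy) / (vx + iC * vy) ^ 2) := by
  simp [hamiltonianDerivation, ← IsPDeriv.derivation_apply (hPd _), A2V_eq, Jz,
    Derivation.leibniz_pow, Derivation.leibniz_inv, derivation_cC, derivation_iC,
    IsPDeriv.derivation_vx, IsPDeriv.derivation_vy, IsPDeriv.derivation_vpx,
    IsPDeriv.derivation_vpy]
  simp only [div_eq_mul_inv, ← inv_pow]
  generalize (vx + iC * vy)⁻¹ = u
  linear_combination (2 * (vx * vpy - vy * vpx) * vpy - (cC γ + 2 * cC β * (vx - iC * vy) * u)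
    * ((vx - iC * vy) * u ^ 2 + u)) * iC_sq

lemma hamiltonianDerivation_A2V_angular {Pd : Fin 6 → K6 → K6} (hPd : ∀ j, IsPDeriv j (Pd j))
    (β γ : ℂ) :
    hamiltonianDerivation hPd (A2V β γ) (-iC * Jz) =
      -2 * cC γ * ((vx - iC * vy) / (vx + iC * vy))
        - 4 * cC β * ((vx - iC * vy) / (vx + iC * vy)) ^ 2 := by
  simp [hamiltonianDerivation, ← IsPDeriv.derivation_apply (hPd _), A2V_eq, Jz,
    Derivation.leibniz_pow, Derivation.leibniz_inv, derivation_cC, derivation_iC,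
    IsPDeriv.derivation_vx, IsPDeriv.derivation_vy, IsPDeriv.derivation_vpx,
    IsPDeriv.derivation_vpy]
  simp only [div_eq_mul_inv, mul_pow, ← inv_pow]
  have hwu := mul_inv_cancel₀ vx_add_iC_mul_vy_ne_zero
  generalize (vx + iC * vy)⁻¹ = u at hwu ⊢
  linear_combination (cC γ + 2 * cC β * (vx - iC * vy) * u) * (
    (-iC * ((vx - iC * vy) * u ^ 2 - u) * vy + 2 * (vx - iC * vy) * u) * iC_sq
      + iC ^ 2 * (vx - iC * vy) * u * hwu)

/-- A derivation acting on `w`, `v`, `p`, `m` as `{A₂, ·}` does on `x + iy`, `x - iy`,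
`p_x + i p_y`, `-i J_z` has the following first and second iterates on `B₂`. -/
lemma derivation_A2V_B2V (D : Derivation ℂ K6 K6) (α β γ : ℂ) {w v p m : K6} (hw : w ≠ 0)
    (hDw : D w = 2 * m * w) (hDv : D v = -2 * m * v)
    (hDp : D p = 2 * m * p + 2 * (cC γ / w + 2 * cC β * v / w ^ 2))
    (hDm : D m = -2 * cC γ * (v / w) - 4 * cC β * (v / w) ^ 2) :
    D (p ^ 2 + cC α * w ^ 2 - cC β / w ^ 2) =
        4 * m * (p ^ 2 + cC α * w ^ 2 + cC β / w ^ 2)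
          + 4 * p * (cC γ / w + 2 * cC β * v / w ^ 2) ∧
    D (4 * m * (p ^ 2 + cC α * w ^ 2 + cC β / w ^ 2)
        + 4 * p * (cC γ / w + 2 * cC β * v / w ^ 2)) =
      -16 * (-m ^ 2 + cC γ * (1 + v / w) - cC β + cC β * (v / w) ^ 2)
          * (p ^ 2 + cC α * w ^ 2 - cC β / w ^ 2)
        - 16 * (cC β - cC γ) * (p ^ 2 + cC α * w ^ 2 - cC β / w ^ 2)
        + 8 * cC γ * ((2 * m * p + v * (p ^ 2 + cC α * w ^ 2 + cC β / w ^ 2)) / w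
          + cC γ / w ^ 2) := by
  have h2 : D 2 = 0 := D.map_natCast 2
  have h4 : D 4 = 0 := D.map_natCast 4
  constructor <;>
  · simp only [div_eq_mul_inv, map_add, map_sub, Derivation.leibniz, Derivation.leibniz_pow,
      Derivation.leibniz_inv, derivation_cC, hDw, hDv, hDp, hDm, h2, h4, smul_eq_mul, nsmul_eq_mul]
    push_cast
    field_simp
    ring

theorem kkm_VII_C2_sq (α β γ δ : ℂ) (Pd : Fin 6 → K6 → K6)
    (hPd : ∀ j, IsPDeriv j (Pd j))
    (H A1 A2 B1 B2 F : K6)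
    (hH : H = HV α β γ δ) (hA1 : A1 = A1V α δ) (hA2 : A2 = A2V β γ)
    (hB1 : B1 = B1V β γ δ) (hB2 : B2 = B2V α β) (hF : F = FV β δ) :
    (poisson Pd A2 B2) ^ 2 =
      2 * (8 * (cC β * (-B2 ^ 2 + (A1 - H) ^ 2 - 4 * cC α * cC β)
        - A2 * (B2 ^ 2 + 4 * cC α * cC β)
        + cC γ * (B2 * (B2 + H - A1) + 4 * cC α * cC β) - cC α * cC γ ^ 2)) ∧
    poisson Pd A2 (poisson Pd A2 B2) =
      -16 * A2 * B2 - 16 * (cC β - cC γ) * B2 - 8 * cC γ * (A1 - H) := by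
  subst hH hA1 hA2 hB2
  have hw := vx_add_iC_mul_vy_ne_zero
  obtain ⟨hC, hCC⟩ := derivation_A2V_B2V (hamiltonianDerivation hPd (A2V β γ)) α β γ hw
    (hamiltonianDerivation_A2V_add hPd β γ) (hamiltonianDerivation_A2V_sub hPd β γ)
    (hamiltonianDerivation_A2V_momentum hPd β γ) (hamiltonianDerivation_A2V_angular hPd β γ)
  have hE := A1V_sub_HV α β γ δ
  have hE' : HV α β γ δ = A1V α δ - (A1V α δ - HV α β γ δ) := by ring
  rw [← hamiltonianDerivation_apply hPd, ← hamiltonianDerivation_apply hPd, B2V, hC, hCC, hE', hE,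
    A2V_eq_neg_sq]
  generalize vx + iC * vy = w at hw ⊢
  generalize vx - iC * vy = v
  generalize vpx + iC * vpy = p
  generalize -iC * Jz = m
  generalize A1V α δ = a
  constructor
  · field_simp
    ring
  · ring
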